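/- There is a constant c > 0 such that for every field F, every n ≥ 2, every integer t with 1 ≤ t ≤ n/2, and every ε ∈ [2^{−n}, 1/3], pdeg^F_ε(Thr_n^t) ≥ c·(√(t·log(1/ε)) + log(1/ε)). -/

import Mathlib

noncomputable section

open scoped BigOperators

/-- Embed a Boolean value into a field: `true ↦ 1`, `false ↦ 0`. -/
def bF (F : Type) [Field F] (b : Bool) : F := if b then 1 else 0

/-- A finitely supported probability distribution on polynomials in
`F[x_1,…,x_n]` (a probabilistic polynomial). -/
structure ProbPoly (F : Type) [Field F] (n : ℕ) where
  k : ℕ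
  w : Fin k → ℝ
  w_nonneg : ∀ i, 0 ≤ w i
  w_sum : ∑ i, w i = 1
  poly : Fin k → MvPolynomial (Fin n) F

open Classical in
/-- The probability that the probabilistic polynomial `P` errs on input `a`
with respect to the Boolean function `f`. -/
def errAt {F : Type} [Field F] {n : ℕ} (P : ProbPoly F n)
    (f : (Fin n → Bool) → Bool) (a : Fin n → Bool) : ℝ :=
  ∑ i, if MvPolynomial.eval (fun v => bF F (a v)) (P.poly i) = bF F (f a) then 0 else P.w i

/-- The ε-error probabilistic degree of a Boolean function over `F`: the least `d`
such that some probabilistic polynomial of degree at most `d` computes `f` with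
error at most `ε` at each point. -/
def pdeg (F : Type) [Field F] {n : ℕ} (f : (Fin n → Bool) → Bool) (ε : ℝ) : ℕ :=
  sInf {d | ∃ P : ProbPoly F n, (∀ i, (P.poly i).totalDegree ≤ d) ∧ ∀ a, errAt P f a ≤ ε}

/-- Hamming weight of a Boolean input. -/
def wt {n : ℕ} (a : Fin n → Bool) : ℕ := (Finset.univ.filter fun i => a i = true).card

/-- The period of a spectrum: the least `b ≥ 1` with `spec i = spec (i+b)`
whenever `i + b ≤ n`. -/
def period (n : ℕ) (spec : ℕ → Bool) : ℕ :=
  sInf {b | 1 ≤ b ∧ ∀ i, i + b ≤ n → spec i = spec (i + b)}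

/-- `B(f)`: the least `k` such that the spectrum is constant on `[k, n-k]`. -/
def Bparam (n : ℕ) (spec : ℕ → Bool) : ℕ :=
  sInf {k | ∀ i j, k ≤ i → i + k ≤ n → k ≤ j → j + k ≤ n → spec i = spec j}
/-- The multilinear monomial function. -/
def chi (F : Type) [Field F] {m : ℕ} (I : Finset (Fin m)) : (Fin m → Bool) → F :=
  fun a => ∏ i ∈ I, bF F (a i)

/-- Functions on the cube of degree at most `k`. -/
def DD (F : Type) [Field F] (m k : ℕ) : Submodule F ((Fin m → Bool) → F) :=
  Submodule.span F (Set.image (chi F) {I : Finset (Fin m) | I.card ≤ k})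

lemma chi_mem (F : Type) [Field F] {m k : ℕ} (I : Finset (Fin m)) (h : I.card ≤ k) :
    chi F I ∈ DD F m k := Submodule.subset_span ⟨I, h, rfl⟩

lemma DD_mono (F : Type) [Field F] {m k l : ℕ} (h : k ≤ l) : DD F m k ≤ DD F m l := by
  apply Submodule.span_mono
  apply Set.image_mono
  intro I hI
  exact le_trans hI h

lemma bF_pow {F : Type} [Field F] (b : Bool) (k : ℕ) (hk : k ≠ 0) : bF F b ^ k = bF F b := by
  cases b <;> simp [bF, hk]

lemma bF_mul_self {F : Type} [Field F] (b : Bool) : bF F b * bF F b = bF F b := by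
  cases b <;> simp [bF]

lemma chi_apply_ite (F : Type) [Field F] {m : ℕ} (I : Finset (Fin m)) (a : Fin m → Bool) :
    chi F I a = if ∀ i ∈ I, a i = true then 1 else 0 := by
  unfold chi
  split_ifs with h
  · exact Finset.prod_eq_one fun i hi => by simp [bF, h i hi]
  · push Not at h
    obtain ⟨i, hi, h⟩ := h
    exact Finset.prod_eq_zero hi (by simp at h; simp [bF, h])

lemma chi_mul (F : Type) [Field F] {m : ℕ} (I J : Finset (Fin m)) :
    chi F I * chi F J = chi F (I ∪ J) := by
  funext a
  have hU : (∀ i ∈ I ∪ J, a i = true) ↔ (∀ i ∈ I, a i = true) ∧ (∀ i ∈ J, a i = true) := by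
    simp only [Finset.mem_union, or_imp, forall_and]
  simp only [Pi.mul_apply, chi_apply_ite, hU, ite_and]
  split_ifs <;> simp

lemma DD_mul {F : Type} [Field F] {m k l : ℕ} {f g : (Fin m → Bool) → F}
    (hf : f ∈ DD F m k) (hg : g ∈ DD F m l) : f * g ∈ DD F m (k + l) := by
  unfold DD at hf
  induction hf using Submodule.span_induction with
  | mem x hx =>
    obtain ⟨I, hI, rfl⟩ := hx
    unfold DD at hg
    induction hg using Submodule.span_induction with
    | mem y hy =>
      obtain ⟨J, hJ, rfl⟩ := hy
      rw [chi_mul]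
      exact chi_mem F _ ((Finset.card_union_le _ _).trans (add_le_add hI hJ))
    | zero => rw [mul_zero]; exact zero_mem _
    | add x y _ _ h1 h2 => rw [mul_add]; exact add_mem h1 h2
    | smul c x _ h1 => rw [mul_smul_comm]; exact Submodule.smul_mem _ _ h1
  | zero => rw [zero_mul]; exact zero_mem _
  | add x y _ _ h1 h2 => rw [add_mul]; exact add_mem h1 h2
  | smul c x _ h1 => rw [smul_mul_assoc]; exact Submodule.smul_mem _ _ h1

lemma one_mem_DD (F : Type) [Field F] (m k : ℕ) : (1 : (Fin m → Bool) → F) ∈ DD F m k := by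
  have : (1 : (Fin m → Bool) → F) = chi F ∅ := by funext a; simp [chi]
  rw [this]
  exact chi_mem F _ (by simp)

/-- A product of functions of degree at most one. -/
lemma prod_mem_DD {F : Type} [Field F] {m : ℕ} {ι : Type} (I : Finset ι)
    (h : ι → (Fin m → Bool) → F) (hh : ∀ i ∈ I, h i ∈ DD F m 1) :
    (fun a => ∏ i ∈ I, h i a) ∈ DD F m I.card := by
  classical
  induction I using Finset.induction_on with
  | empty => exact one_mem_DD F m 0
  | insert i I hi ih =>
    rw [Finset.card_insert_of_notMem hi, add_comm]
    have : (fun a => ∏ j ∈ insert i I, h j a) = h i * (fun a => ∏ j ∈ I, h j a) := by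
      funext a
      simp [Finset.prod_insert hi]
    rw [this]
    exact DD_mul (hh i (by simp)) (ih fun j hj => hh j (Finset.mem_insert_of_mem hj))

/-- Composition with a map whose coordinates have degree at most one. -/
lemma DD_comp {F : Type} [Field F] {m n k : ℕ} (e : (Fin m → Bool) → (Fin n → Bool))
    (he : ∀ i, (fun a => bF F (e a i)) ∈ DD F m 1) {g : (Fin n → Bool) → F}
    (hg : g ∈ DD F n k) : (fun a => g (e a)) ∈ DD F m k := by
  unfold DD at hg
  induction hg using Submodule.span_induction with
  | mem x hx =>
    obtain ⟨I, hI, rfl⟩ := hx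
    exact DD_mono F hI (prod_mem_DD I (fun i a => bF F (e a i)) (fun i _ => he i))
  | zero => exact zero_mem _
  | add x y _ _ h1 h2 => exact add_mem h1 h2
  | smul c x _ h1 => exact Submodule.smul_mem _ c h1

lemma coord_mem {F : Type} [Field F] {m : ℕ} (i : Fin m) :
    (fun a : Fin m → Bool => bF F (a i)) ∈ DD F m 1 := by
  have : (fun a : Fin m → Bool => bF F (a i)) = chi F {i} := by funext a; simp [chi]
  rw [this]
  exact chi_mem F _ (by simp)

lemma const_mem {F : Type} [Field F] {m k : ℕ} (c : F) :
    (fun _ : Fin m → Bool => c) ∈ DD F m k := by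
  have : (fun _ : Fin m → Bool => c) = c • (1 : (Fin m → Bool) → F) := by funext a; simp
  rw [this]
  exact Submodule.smul_mem _ _ (one_mem_DD F m k)

lemma poly_mem {F : Type} [Field F] {n d : ℕ} (p : MvPolynomial (Fin n) F)
    (hp : p.totalDegree ≤ d) :
    (fun a : Fin n → Bool => MvPolynomial.eval (fun v => bF F (a v)) p) ∈ DD F n d := by
  have : (fun a : Fin n → Bool => MvPolynomial.eval (fun v => bF F (a v)) p)
      = ∑ s ∈ p.support, p.coeff s • chi F s.support := by
    funext a
    rw [MvPolynomial.eval_eq, Finset.sum_apply]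
    refine Finset.sum_congr rfl fun s _ => ?_
    simp only [Pi.smul_apply, smul_eq_mul, chi]
    congr 1
    refine Finset.prod_congr rfl fun i hi => bF_pow _ _ (Finsupp.mem_support_iff.1 hi)
  rw [this]
  refine Submodule.sum_mem _ fun s hs => Submodule.smul_mem _ _ (chi_mem F _ ?_)
  refine le_trans ?_ ((MvPolynomial.le_totalDegree hs).trans hp)
  rw [Finsupp.sum, Finset.card_eq_sum_ones]
  exact Finset.sum_le_sum fun i hi => Nat.one_le_iff_ne_zero.2 (Finsupp.mem_support_iff.1 hi)

lemma exists_poly {F : Type} [Field F] {n k : ℕ} {g : (Fin n → Bool) → F} (hg : g ∈ DD F n k) :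
    ∃ p : MvPolynomial (Fin n) F, ∀ a, MvPolynomial.eval (fun v => bF F (a v)) p = g a := by
  unfold DD at hg
  induction hg using Submodule.span_induction with
  | mem x hx =>
    obtain ⟨I, hI, rfl⟩ := hx
    exact ⟨∏ i ∈ I, MvPolynomial.X i, fun a => by simp [chi]⟩
  | zero => exact ⟨0, fun a => by simp⟩
  | add x y _ _ h1 h2 =>
    obtain ⟨p, hp⟩ := h1
    obtain ⟨q, hq⟩ := h2
    exact ⟨p + q, fun a => by simp [hp, hq]⟩
  | smul c x _ h1 =>
    obtain ⟨p, hp⟩ := h1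
    exact ⟨MvPolynomial.C c * p, fun a => by simp [hp]⟩

/-- Support of a point of the cube. -/
def supp {m : ℕ} (a : Fin m → Bool) : Finset (Fin m) := Finset.univ.filter fun i => a i = true

lemma chi_apply_supp (F : Type) [Field F] {m : ℕ} (I : Finset (Fin m)) (a : Fin m → Bool) :
    chi F I a = if I ⊆ supp a then 1 else 0 := by
  rw [chi_apply_ite]
  congr 1
  simp [supp, Finset.subset_iff]

/-- Interpolation on the Hamming ball of radius `k`. -/
lemma interp_low {F : Type} [Field F] {m : ℕ} (f : (Fin m → Bool) → F) (k : ℕ) :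
    ∃ g ∈ DD F m k, ∀ a, wt a ≤ k → g a = f a := by
  classical
  have key : ∀ k, (∃ g ∈ DD F m k, ∀ a, wt a < k → g a = f a) →
      ∃ g ∈ DD F m k, ∀ a, wt a ≤ k → g a = f a := by
    rintro k ⟨g, hg, hga⟩
    let pt : Finset (Fin m) → Fin m → Bool := fun I i => decide (i ∈ I)
    have hpt : ∀ a, pt (supp a) = a := by
      intro a; funext i; simp [pt, supp]
    refine ⟨g + ∑ I ∈ Finset.univ.filter (fun I : Finset (Fin m) => I.card = k),
      (f (pt I) - g (pt I)) • chi F I, add_mem hg (Submodule.sum_mem _ fun I hI =>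
        Submodule.smul_mem _ _ (chi_mem F _ (by simp at hI; omega))), fun a ha => ?_⟩
    have hw : (supp a).card = wt a := rfl
    simp only [Pi.add_apply, Finset.sum_apply, Pi.smul_apply, smul_eq_mul, chi_apply_supp]
    rcases ha.lt_or_eq with h | h
    · rw [Finset.sum_eq_zero, add_zero, hga a h]
      intro I hI
      simp only [Finset.mem_filter, Finset.mem_univ, true_and] at hI
      rw [if_neg, mul_zero]
      intro hs
      have := Finset.card_le_card hs
      omega
    · rw [Finset.sum_eq_single (supp a)]
      · simp [hpt]
      · intro I hI hne
        simp only [Finset.mem_filter, Finset.mem_univ, true_and] at hI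
        rw [if_neg, mul_zero]
        intro hs
        exact hne (Finset.eq_of_subset_of_card_le hs (by omega))
      · intro hh
        simp at hh
        omega
  induction k with
  | zero => exact key 0 ⟨0, zero_mem _, fun a ha => by omega⟩
  | succ k ih =>
    obtain ⟨g, hg, hga⟩ := ih
    exact key _ ⟨g, DD_mono F (Nat.le_succ k) hg, fun a ha => hga a (by omega)⟩

lemma wt_le {m : ℕ} (a : Fin m → Bool) : wt a ≤ m := by
  unfold wt
  exact (Finset.card_le_univ _).trans (by simp)

lemma wt_not {m : ℕ} (a : Fin m → Bool) : wt (fun i => !a i) + wt a = m := by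
  have := Finset.card_filter_add_card_filter_not (s := (Finset.univ : Finset (Fin m)))
    (fun i => a i = true)
  simp only [Finset.card_univ, Fintype.card_fin] at this
  unfold wt
  simp only [Bool.not_eq_true', Bool.not_eq_true] at *
  omega

/-- Interpolation on points of large weight. -/
lemma interp_high {F : Type} [Field F] {m : ℕ} (f : (Fin m → Bool) → F) (k : ℕ) :
    ∃ g ∈ DD F m k, ∀ a, m ≤ wt a + k → g a = f a := by
  obtain ⟨g, hg, hga⟩ := interp_low (fun a => f (fun i => !a i)) k
  refine ⟨fun a => g (fun i => !a i), DD_comp (fun a i => !a i) ?_ hg, fun a ha => ?_⟩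
  · intro i
    have : (fun a : Fin m → Bool => bF F (!a i)) = (fun _ => (1 : F)) - fun a => bF F (a i) := by
      funext a
      cases h : a i <;> simp [bF, h]
    rw [this]
    exact sub_mem (const_mem 1) (coord_mem i)
  · have := wt_not a
    change g (fun i => !a i) = f a
    rw [hga _ (by omega)]
    simp

open Classical in
lemma finrank_DD (F : Type) [Field F] (m k : ℕ) :
    Module.finrank F (DD F m k) ≤
      (Finset.univ.filter fun I : Finset (Fin m) => I.card ≤ k).card := by
  have : DD F m k = Submodule.span F
      (((Finset.univ.filter fun I : Finset (Fin m) => I.card ≤ k).image (chi F) :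
        Finset ((Fin m → Bool) → F)) : Set ((Fin m → Bool) → F)) := by
    unfold DD
    congr 1
    ext x
    simp
  rw [this]
  exact (finrank_span_finset_le_card _).trans Finset.card_image_le

open Classical in
/-- Smolensky's bound. -/
lemma smolensky {F : Type} [Field F] (t d : ℕ) (g : (Fin (2 * t) → Bool) → F)
    (hg : g ∈ DD F (2 * t) d) :
    (Finset.univ.filter fun I : Finset (Fin (2 * t)) => t + d < I.card).card ≤
      (Finset.univ.filter fun a : Fin (2 * t) → Bool => ¬ g a = bF F (decide (t ≤ wt a))).card := by
  set S := Finset.univ.filter fun a : Fin (2 * t) → Bool => g a = bF F (decide (t ≤ wt a)) with hS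
  let ρ : ((Fin (2 * t) → Bool) → F) →ₗ[F] (S → F) := LinearMap.funLeft F F (fun x => x.1)
  have htop : (DD F (2 * t) (t + d)).map ρ = ⊤ := by
    rw [eq_top_iff]
    intro f _
    let f' : (Fin (2 * t) → Bool) → F := fun a => if h : a ∈ S then f ⟨a, h⟩ else 0
    obtain ⟨f0, h0, h0'⟩ := interp_low f' t
    obtain ⟨f1, h1, h1'⟩ := interp_high f' t
    refine ⟨f0 + g * (f1 - f0), add_mem (DD_mono F (by omega) h0) ?_, ?_⟩
    · rw [add_comm t d]
      exact DD_mul hg (sub_mem h1 h0)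
    · funext ⟨a, ha⟩
      have hga : g a = bF F (decide (t ≤ wt a)) := (Finset.mem_filter.1 ha).2
      have hf' : f' a = f ⟨a, ha⟩ := by simp only [f']; rw [dif_pos ha]
      change f0 a + g a * (f1 a - f0 a) = _
      rw [hga]
      by_cases hw : t ≤ wt a
      · simp only [hw, decide_true, bF, if_true]
        rw [h1' a (by omega), hf']; ring
      · simp only [hw, decide_false, bF]
        rw [h0' a (by omega), hf']; simp
  have h1 : S.card ≤ (Finset.univ.filter fun I : Finset (Fin (2 * t)) => I.card ≤ t + d).card := by
    have h2 : Module.finrank F (S → F) = S.card := by simp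
    rw [← h2, ← finrank_top F (S → F), ← htop]
    exact (Submodule.finrank_map_le _ _).trans (finrank_DD F _ _)
  have h3 := Finset.card_filter_add_card_filter_not
    (s := (Finset.univ : Finset (Fin (2 * t) → Bool))) (fun a => g a = bF F (decide (t ≤ wt a)))
  have h4 := Finset.card_filter_add_card_filter_not
    (s := (Finset.univ : Finset (Finset (Fin (2 * t))))) (fun I => I.card ≤ t + d)
  simp only [not_le] at h4
  have h5 : (Finset.univ : Finset (Fin (2 * t) → Bool)).card
      = (Finset.univ : Finset (Finset (Fin (2 * t)))).card := by simp
  rw [← hS] at h3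
  omega

/-- Sign character. -/
def sgn (F : Type) [Field F] {m : ℕ} (a : Fin m → Bool) : F := ∏ i, (if a i then (-1 : F) else 1)

lemma sum_sgn_chi {F : Type} [Field F] {m : ℕ} (I : Finset (Fin m)) (h : I.card < m) :
    ∑ a : Fin m → Bool, sgn F a * chi F I a = 0 := by
  have : ∀ a : Fin m → Bool, sgn F a * chi F I a =
      ∏ i, (fun (i : Fin m) (b : Bool) =>
        (if b then (-1 : F) else 1) * (if i ∈ I then bF F b else 1)) i (a i) := by
    intro a
    unfold sgn chi
    rw [Finset.prod_mul_distrib]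
    congr 1
    simp [Finset.prod_ite_mem]
  rw [Finset.sum_congr rfl fun a _ => this a]
  refine (Fintype.prod_sum (fun (i : Fin m) (b : Bool) =>
    (if b then (-1 : F) else 1) * (if i ∈ I then bF F b else 1))).symm.trans ?_
  obtain ⟨i, hi⟩ : ∃ i, i ∉ I := by
    by_contra hc
    push Not at hc
    have : I = Finset.univ := Finset.eq_univ_iff_forall.2 hc
    rw [this] at h
    simp at h
  apply Finset.prod_eq_zero (Finset.mem_univ i)
  simp [hi]

lemma sum_sgn_DD {F : Type} [Field F] {m k : ℕ} (h : k < m) {g : (Fin m → Bool) → F}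
    (hg : g ∈ DD F m k) : ∑ a : Fin m → Bool, sgn F a * g a = 0 := by
  unfold DD at hg
  induction hg using Submodule.span_induction with
  | mem x hx =>
    obtain ⟨I, hI, rfl⟩ := hx
    exact sum_sgn_chi I (lt_of_le_of_lt hI h)
  | zero => simp
  | add x y _ _ h1 h2 => simp only [Pi.add_apply, mul_add, Finset.sum_add_distrib, h1, h2, add_zero]
  | smul c x _ h1 =>
    simp only [Pi.smul_apply, smul_eq_mul, mul_left_comm _ c, ← Finset.mul_sum, h1, mul_zero]

open Classical in
lemma or_bound {F : Type} [Field F] (d : ℕ) (g : (Fin (d + 1) → Bool) → F)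
    (hg : g ∈ DD F (d + 1) d) :
    1 ≤ (Finset.univ.filter fun a : Fin (d + 1) → Bool =>
      ¬ g a = bF F (decide (1 ≤ wt a))).card := by
  by_contra hc
  have h0 : ∀ a, g a = bF F (decide (1 ≤ wt a)) := by
    intro a
    by_contra h
    exact hc (Finset.card_pos.2 ⟨a, by simp [h]⟩)
  have h1 := sum_sgn_DD (Nat.lt_succ_self d) (sub_mem (one_mem_DD F (d + 1) d) hg)
  rw [Finset.sum_eq_single (fun _ => false)] at h1
  · simp [sgn, h0, bF, wt] at h1
  · intro a _ hne
    have : 1 ≤ wt a := by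
      apply Finset.card_pos.2
      by_contra he
      apply hne
      funext i
      by_contra hi
      exact he ⟨i, by simpa using hi⟩
    simp [h0, bF, this]
  · simp

/-- Embedding of a smaller cube, with `j` coordinates fixed to true and the rest to false. -/
def emb (m j n : ℕ) (a : Fin m → Bool) : Fin n → Bool :=
  fun i => if h : i.1 < m then a ⟨i.1, h⟩ else decide (i.1 < m + j)

lemma wt_emb {m j n : ℕ} (h : m + j ≤ n) (a : Fin m → Bool) : wt (emb m j n a) = wt a + j := by
  obtain ⟨r, rfl⟩ := Nat.exists_eq_add_of_le h
  have hs : ∀ {k : ℕ} (b : Fin k → Bool), wt b = ∑ i, if b i = true then 1 else 0 := by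
    intro k b; simp [wt]
  rw [hs, hs, Fin.sum_univ_add, Fin.sum_univ_add]
  have h1 : ∀ i : Fin m, emb m j (m + j + r) a (Fin.castAdd r (Fin.castAdd j i)) = a i := by
    intro i; simp [emb]
  have h2 : ∀ i : Fin j, emb m j (m + j + r) a (Fin.castAdd r (Fin.natAdd m i)) = true := by
    intro i; simp [emb]
  have h3 : ∀ i : Fin r, emb m j (m + j + r) a (Fin.natAdd (m + j) i) = false := by
    intro i
    have : ¬ (m + j + i.1 < m) := by omega
    simp [emb, this]
  simp [h1, h2, h3]

lemma emb_mem {F : Type} [Field F] {m j n : ℕ} (i : Fin n) :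
    (fun a => bF F (emb m j n a i)) ∈ DD F m 1 := by
  by_cases h : i.1 < m
  · simpa [emb, h] using coord_mem (F := F) (⟨i.1, h⟩ : Fin m)
  · simpa [emb, h] using const_mem (F := F) (m := m) (k := 1) (bF F (decide (i.1 < m + j)))

open Classical in
lemma averaging {F : Type} [Field F] {n m : ℕ} (P : ProbPoly F n) (f : (Fin n → Bool) → Bool)
    (ε : ℝ) (hP : ∀ a, errAt P f a ≤ ε) (e : (Fin m → Bool) → (Fin n → Bool)) (N : ℕ)
    (hN : ∀ i, N ≤ (Finset.univ.filter fun a : Fin m → Bool =>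
      ¬ MvPolynomial.eval (fun v => bF F (e a v)) (P.poly i) = bF F (f (e a))).card) :
    (N : ℝ) ≤ ε * 2 ^ m := by
  calc (N : ℝ) = ∑ i, P.w i * N := by rw [← Finset.sum_mul, P.w_sum, one_mul]
    _ ≤ ∑ i, P.w i * ((Finset.univ.filter fun a : Fin m → Bool =>
      ¬ MvPolynomial.eval (fun v => bF F (e a v)) (P.poly i) = bF F (f (e a))).card : ℝ) :=
        Finset.sum_le_sum fun i _ =>
          mul_le_mul_of_nonneg_left (by exact_mod_cast hN i) (P.w_nonneg i)
    _ = ∑ i, ∑ a : Fin m → Bool, (if MvPolynomial.eval (fun v => bF F (e a v)) (P.poly i)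
          = bF F (f (e a)) then 0 else P.w i) := by
        refine Finset.sum_congr rfl fun i _ => ?_
        rw [Finset.card_filter, Nat.cast_sum, Finset.mul_sum]
        refine Finset.sum_congr rfl fun a _ => ?_
        split_ifs <;> simp
    _ = ∑ a : Fin m → Bool, errAt P f (e a) := by
        rw [Finset.sum_comm]
        rfl
    _ ≤ ∑ a : Fin m → Bool, ε := Finset.sum_le_sum fun a _ => hP _
    _ = ε * 2 ^ m := by simp [mul_comm]

lemma pdeg_spec (F : Type) [Field F] {n : ℕ} (f : (Fin n → Bool) → Bool) (ε : ℝ) (hε : 0 ≤ ε) :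
    ∃ P : ProbPoly F n, (∀ i, (P.poly i).totalDegree ≤ pdeg F f ε) ∧ ∀ a, errAt P f a ≤ ε := by
  have hne : {d | ∃ P : ProbPoly F n, (∀ i, (P.poly i).totalDegree ≤ d) ∧
      ∀ a, errAt P f a ≤ ε}.Nonempty := by
    obtain ⟨g, hg, hga⟩ := interp_low (fun a => bF F (f a)) n
    obtain ⟨p, hp⟩ := exists_poly hg
    refine ⟨p.totalDegree, ⟨1, fun _ => 1, by simp, by simp, fun _ => p⟩, fun i => le_rfl, ?_⟩
    intro a
    simp only [errAt]
    simpa [hp, hga a (wt_le a)] using hε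
  exact Nat.sInf_mem hne

lemma cb_upper (t : ℕ) : t.centralBinom ^ 2 * (2 * t + 1) ≤ 16 ^ t := by
  induction t with
  | zero => simp
  | succ t ih =>
    have h := Nat.succ_mul_centralBinom_succ t
    set q := t.centralBinom
    set q' := (t + 1).centralBinom
    have h1 : (t + 1) ^ 2 * (q' ^ 2 * (2 * (t + 1) + 1)) ≤ (t + 1) ^ 2 * 16 ^ (t + 1) := by
      calc (t + 1) ^ 2 * (q' ^ 2 * (2 * (t + 1) + 1))
          = ((t + 1) * q') ^ 2 * (2 * t + 3) := by ring
        _ = (q ^ 2 * (2 * t + 1)) * (4 * (2 * t + 1) * (2 * t + 3)) := by rw [h]; ring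
        _ ≤ 16 ^ t * (16 * (t + 1) ^ 2) := by
          apply Nat.mul_le_mul ih
          nlinarith
        _ = (t + 1) ^ 2 * 16 ^ (t + 1) := by ring
    exact Nat.le_of_mul_le_mul_left h1 (by positivity)

lemma cb_lower (t : ℕ) (ht : 1 ≤ t) : 16 ^ t ≤ 4 * t * t.centralBinom ^ 2 := by
  induction t, ht using Nat.le_induction with
  | base => simp [Nat.centralBinom, Nat.choose]
  | succ t ht ih =>
    have h := Nat.succ_mul_centralBinom_succ t
    set q := t.centralBinom
    set q' := (t + 1).centralBinom
    have h1 : (t + 1) ^ 2 * 16 ^ (t + 1) ≤ (t + 1) ^ 2 * (4 * (t + 1) * q' ^ 2) := by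
      calc (t + 1) ^ 2 * 16 ^ (t + 1) = 16 ^ t * (16 * (t + 1) ^ 2) := by ring
        _ ≤ (4 * t * q ^ 2) * (16 * (t + 1) ^ 2) := Nat.mul_le_mul_right _ ih
        _ = (4 * t * (t + 1)) * (16 * (t + 1) * q ^ 2) := by ring
        _ ≤ ((2 * t + 1) ^ 2) * (16 * (t + 1) * q ^ 2) := by
          apply Nat.mul_le_mul_right
          nlinarith
        _ = 4 * (t + 1) * ((t + 1) * q') ^ 2 := by rw [h]; ring
        _ = (t + 1) ^ 2 * (4 * (t + 1) * q' ^ 2) := by ring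
    exact Nat.le_of_mul_le_mul_left h1 (by positivity)

/-- The upper tail of the binomial coefficients. -/
def tail (t d : ℕ) : ℕ :=
  (Finset.univ.filter fun I : Finset (Fin (2 * t)) => t + d < I.card).card

lemma tail_eq (t d : ℕ) :
    tail t d = ∑ k ∈ Finset.range (2 * t + 1), if t + d < k then (2 * t).choose k else 0 := by
  unfold tail
  rw [Finset.card_filter, ← Finset.powerset_univ,
    Finset.sum_powerset_apply_card (fun k => if t + d < k then 1 else 0)]
  simp

lemma tail_half (t d : ℕ) : 4 ^ t ≤ 2 * tail t d + (2 * d + 1) * t.centralBinom := by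
  have h2 : tail t d = ∑ k ∈ Finset.range (2 * t + 1),
      if t + d < 2 * t - k then (2 * t).choose (2 * t - k) else 0 := by
    rw [tail_eq]
    exact (Finset.sum_flip (fun k => if t + d < k then (2 * t).choose k else 0)).symm
  have h3 : ∑ k ∈ Finset.range (2 * t + 1),
      (if k ∈ Finset.Icc (t - d) (t + d) then t.centralBinom else 0)
        ≤ (2 * d + 1) * t.centralBinom := by
    rw [← Finset.sum_filter, Finset.sum_const, smul_eq_mul]
    apply Nat.mul_le_mul_right
    calc _ ≤ (Finset.Icc (t - d) (t + d)).card := by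
          apply Finset.card_le_card
          intro k hk
          exact (Finset.mem_filter.1 hk).2
      _ ≤ _ := by rw [Nat.card_Icc]; omega
  calc 4 ^ t = ∑ k ∈ Finset.range (2 * t + 1), (2 * t).choose k := by
        rw [Nat.sum_range_choose, pow_mul]; norm_num
    _ ≤ ∑ k ∈ Finset.range (2 * t + 1), ((if t + d < k then (2 * t).choose k else 0) +
        (if t + d < 2 * t - k then (2 * t).choose (2 * t - k) else 0) +
        (if k ∈ Finset.Icc (t - d) (t + d) then t.centralBinom else 0)) := by
        refine Finset.sum_le_sum fun k hk => ?_
        rw [Finset.mem_range] at hk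
        rw [Nat.choose_symm (show k ≤ 2 * t by omega)]
        have hq := Nat.choose_le_centralBinom k t
        simp only [Finset.mem_Icc]
        split_ifs <;> omega
    _ = tail t d + tail t d + ∑ k ∈ Finset.range (2 * t + 1),
      (if k ∈ Finset.Icc (t - d) (t + d) then t.centralBinom else 0) := by
        rw [Finset.sum_add_distrib, Finset.sum_add_distrib, ← tail_eq, ← h2]
    _ ≤ _ := by omega

lemma choose_lower (t J : ℕ) (ht : 1 ≤ t) (hJ : J ≤ t) (j : ℕ) (hj : j ≤ J) :
    (t.centralBinom : ℝ) * (((t : ℝ) - J) / (t + J)) ^ j ≤ (2 * t).choose (t + j) := by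
  have ht' : (1 : ℝ) ≤ t := by exact_mod_cast ht
  have hJ' : (J : ℝ) ≤ t := by exact_mod_cast hJ
  induction j with
  | zero => simp [Nat.centralBinom]
  | succ j ih =>
    have ih := ih (by omega)
    have h1 := Nat.choose_succ_right_eq (2 * t) (t + j)
    have h2 : 2 * t - (t + j) = t - j := by omega
    rw [h2] at h1
    have h3 : ((2 * t).choose (t + j + 1) : ℝ) * (t + j + 1) = (2 * t).choose (t + j) * (t - j) := by
      have : ((t - j : ℕ) : ℝ) = (t : ℝ) - j := by rw [Nat.cast_sub (by omega)]
      rw [← this]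
      exact_mod_cast h1
    have hj' : (j : ℝ) + 1 ≤ J := by exact_mod_cast hj
    have hj0 : (0 : ℝ) ≤ j := Nat.cast_nonneg j
    have h4 : ((2 * t).choose (t + j + 1) : ℝ)
        = (2 * t).choose (t + j) * (((t : ℝ) - j) / (t + j + 1)) := by
      rw [← mul_div_assoc, ← h3]
      field_simp
    have h5 : ((t : ℝ) - J) / (t + J) ≤ ((t : ℝ) - j) / (t + j + 1) := by
      apply div_le_div₀ <;> linarith
    have h6 : 0 ≤ ((t : ℝ) - J) / (t + J) := div_nonneg (by linarith) (by linarith)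
    rw [← add_assoc, h4, pow_succ, ← mul_assoc]
    exact mul_le_mul ih h5 h6 (Nat.cast_nonneg _)

lemma tail_lower (t d : ℕ) (hd : 1 ≤ d) (h8 : 8 * d ≤ t) :
    (d : ℝ) * t.centralBinom * Real.exp (-(11 * (d ^ 2 / t))) ≤ tail t d := by
  have hd' : (1 : ℝ) ≤ d := by exact_mod_cast hd
  have h8' : 8 * (d : ℝ) ≤ t := by exact_mod_cast h8
  set r : ℝ := ((t : ℝ) - (2 * d : ℕ)) / (t + (2 * d : ℕ)) with hr
  have hr0 : 0 < r := by
    rw [hr]; push_cast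
    exact div_pos (by linarith) (by linarith)
  have hr1 : r ≤ 1 := by
    rw [hr, div_le_one] <;> push_cast <;> linarith
  have hrexp : Real.exp (-(11 * (d ^ 2 / t))) ≤ r ^ (2 * d) := by
    have h1 : r⁻¹ ≤ Real.exp (16 * d / (3 * t)) := by
      have h2 : r⁻¹ ≤ 16 * d / (3 * t) + 1 := by
        rw [hr, inv_div, div_le_iff₀ (by push_cast; linarith)]
        push_cast
        have : 0 < (t : ℝ) := by linarith
        field_simp
        nlinarith
      exact h2.trans (Real.add_one_le_exp _)
    have h2 : Real.exp (-(16 * d / (3 * t))) ≤ r := by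
      rw [Real.exp_neg]
      exact inv_le_of_inv_le₀ hr0 h1
    calc Real.exp (-(11 * (d ^ 2 / t))) ≤ Real.exp ((2 * d : ℕ) * (-(16 * d / (3 * t)))) := by
          apply Real.exp_le_exp.2
          push_cast
          have : 0 < (t : ℝ) := by linarith
          have h3 : (2 * (d:ℝ)) * (-(16 * d / (3 * t))) = -(32 / 3 * (d ^ 2 / t)) := by
            field_simp
            norm_num
          rw [h3]
          have : 0 ≤ (d : ℝ) ^ 2 / t := by positivity
          linarith
      _ = Real.exp (-(16 * d / (3 * t))) ^ (2 * d) := Real.exp_nat_mul _ _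
      _ ≤ r ^ (2 * d) := pow_le_pow_left₀ (Real.exp_pos _).le h2 _
  have h1 : ∑ k ∈ Finset.Ioc (t + d) (t + 2 * d), (2 * t).choose k ≤ tail t d := by
    rw [tail_eq, ← Finset.sum_filter]
    apply Finset.sum_le_sum_of_subset
    intro k hk
    simp only [Finset.mem_Ioc, Finset.mem_filter, Finset.mem_range] at *
    omega
  calc (d : ℝ) * t.centralBinom * Real.exp (-(11 * (d ^ 2 / t)))
      ≤ (d : ℝ) * t.centralBinom * r ^ (2 * d) := by gcongr
    _ = ∑ k ∈ Finset.Ioc (t + d) (t + 2 * d), (t.centralBinom : ℝ) * r ^ (2 * d) := by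
        rw [Finset.sum_const, Nat.card_Ioc, nsmul_eq_mul]
        have : t + 2 * d - (t + d) = d := by omega
        rw [this]; ring
    _ ≤ ∑ k ∈ Finset.Ioc (t + d) (t + 2 * d), ((2 * t).choose k : ℝ) := by
        refine Finset.sum_le_sum fun k hk => ?_
        rw [Finset.mem_Ioc] at hk
        obtain ⟨j, rfl⟩ := Nat.exists_eq_add_of_le (show t ≤ k by omega)
        refine le_trans ?_ (choose_lower t (2 * d) (by omega) (by omega) j (by omega))
        apply mul_le_mul_of_nonneg_left _ (Nat.cast_nonneg _)
        exact pow_le_pow_of_le_one hr0.le hr1 (by omega)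
    _ ≤ tail t d := by exact_mod_cast h1

/-- The analytic part: from the tail bound to the logarithmic bound. -/
lemma analytic (t d : ℕ) (ht : 1 ≤ t) (hd : 1 ≤ d) (ε : ℝ) (h0 : 0 < ε) (h3 : ε ≤ 1 / 3)
    (hL : Real.logb 2 (1 / ε) ≤ 2 * d) (hT : (tail t d : ℝ) ≤ ε * 4 ^ t) :
    t * Real.logb 2 (1 / ε) ≤ (15 * d) ^ 2 := by
  have hd' : (1 : ℝ) ≤ d := by exact_mod_cast hd
  have ht' : (1 : ℝ) ≤ t := by exact_mod_cast ht
  by_cases h8 : t < 8 * d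
  · have h8' : (t : ℝ) ≤ 8 * d := by exact_mod_cast h8.le
    calc t * Real.logb 2 (1 / ε) ≤ t * (2 * d) := by gcongr
      _ ≤ (8 * d) * (2 * d) := by gcongr
      _ ≤ (15 * d) ^ 2 := by nlinarith
  push Not at h8
  set q : ℝ := (t.centralBinom : ℝ) with hq
  have hq0 : 0 < q := by rw [hq]; exact_mod_cast t.centralBinom_pos
  have h16 : (16 : ℝ) ^ t = (4 ^ t) ^ 2 := by rw [← pow_mul, mul_comm, pow_mul]; norm_num
  have hX : (0 : ℝ) < 4 ^ t := by positivity
  have hup : q ^ 2 * (2 * t + 1) ≤ (4 ^ t) ^ 2 := by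
    rw [← h16, hq]; exact_mod_cast cb_upper t
  have hlo : ((4 : ℝ) ^ t) ^ 2 ≤ 4 * t * q ^ 2 := by
    rw [← h16, hq]; exact_mod_cast cb_lower t ht
  have hhalf : (4 : ℝ) ^ t ≤ 2 * tail t d + (2 * d + 1) * q := by rw [hq]; exact_mod_cast tail_half t d
  have hlow := tail_lower t d hd h8
  rw [← hq] at hlow
  have hA : (4 : ℝ) ^ t ≤ 9 * d * q := by
    have : ε * 4 ^ t ≤ 1 / 3 * 4 ^ t := by gcongr
    nlinarith
  have ht41 : (t : ℝ) ≤ 41 * d ^ 2 := by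
    have h1 : ((4 : ℝ) ^ t) ^ 2 ≤ (9 * d * q) ^ 2 := pow_le_pow_left₀ hX.le hA 2
    have h2 : q ^ 2 * (2 * t + 1) ≤ q ^ 2 * (81 * d ^ 2) := by nlinarith
    have h4 := le_of_mul_le_mul_left h2 (by positivity)
    linarith
  have hB : (4 : ℝ) ^ t ≤ 14 * (d * q) := by
    apply le_of_sq_le_sq _ (by positivity)
    calc ((4 : ℝ) ^ t) ^ 2 ≤ 4 * t * q ^ 2 := hlo
      _ ≤ 4 * (41 * d ^ 2) * q ^ 2 := by gcongr
      _ ≤ (14 * (d * q)) ^ 2 := by nlinarith [sq_nonneg ((d : ℝ) * q)]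
  set x : ℝ := (d : ℝ) ^ 2 / t with hx
  have hx41 : 1 ≤ 41 * x := by
    rw [hx, ← mul_div_assoc, le_div_iff₀ (by linarith)]
    linarith
  have he : Real.exp (-(11 * x)) ≤ 14 * ε := by
    have : 4 ^ t * Real.exp (-(11 * x)) ≤ 4 ^ t * (14 * ε) := by
      calc 4 ^ t * Real.exp (-(11 * x)) ≤ 14 * (d * q) * Real.exp (-(11 * x)) := by gcongr
        _ = 14 * (d * q * Real.exp (-(11 * x))) := by ring
        _ ≤ 14 * (ε * 4 ^ t) := by linarith
        _ = _ := by ring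
    exact le_of_mul_le_mul_left this hX
  have h14 : (14 : ℝ) ≤ Real.exp 3 := by
    have h1 : Real.exp 3 = Real.exp 1 ^ 3 := by rw [← Real.exp_nat_mul]; norm_num
    rw [h1]
    have h2 := Real.exp_one_gt_d9
    calc (14 : ℝ) ≤ 2.5 ^ 3 := by norm_num
      _ ≤ _ := by gcongr; linarith
  have hlog : Real.log (1 / ε) ≤ 134 * x := by
    rw [Real.log_le_iff_le_exp (by positivity)]
    rw [div_le_iff₀ h0]
    have h1 : Real.exp (11 * x) * Real.exp (-(11 * x)) = 1 := by
      rw [← Real.exp_add]; simp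
    calc 1 = Real.exp (11 * x) * Real.exp (-(11 * x)) := h1.symm
      _ ≤ Real.exp (11 * x) * (Real.exp 3 * ε) := by
        apply mul_le_mul_of_nonneg_left _ (Real.exp_pos _).le
        exact he.trans (by gcongr)
      _ = Real.exp (11 * x + 3) * ε := by rw [Real.exp_add]; ring
      _ ≤ Real.exp (134 * x) * ε := by gcongr; linarith
  have hl2 := Real.log_two_gt_d9
  have hLx : Real.logb 2 (1 / ε) ≤ 200 * x := by
    rw [Real.logb, div_le_iff₀ (by linarith)]
    nlinarith
  calc t * Real.logb 2 (1 / ε) ≤ t * (200 * x) := by gcongr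
    _ = 200 * d ^ 2 := by rw [hx]; field_simp
    _ ≤ (15 * d) ^ 2 := by nlinarith

/-- lower bound `Ω(√(t log(1/ε)) + log(1/ε))` for the threshold
function `Thr_n^t` with `1 ≤ t ≤ n/2`. -/
theorem stmt16 :
    ∃ c : ℝ, 0 < c ∧
      ∀ (F : Type) [Field F] (n t : ℕ), 2 ≤ n → 1 ≤ t → 2 * t ≤ n →
        ∀ ε : ℝ, 1 / (2:ℝ)^n ≤ ε → ε ≤ 1/3 →
          c * (Real.sqrt (t * Real.logb 2 (1/ε)) + Real.logb 2 (1/ε))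
            ≤ (pdeg F (fun a : Fin n → Bool => decide (t ≤ wt a)) ε : ℝ) := by
  classical
  refine ⟨1 / 17, by norm_num, ?_⟩
  intro F _ n t hn ht htn ε hε hε3
  have h0 : 0 < ε := lt_of_lt_of_le (by positivity) hε
  obtain ⟨P, hdeg, herr⟩ := pdeg_spec F (fun a : Fin n → Bool => decide (t ≤ wt a)) ε h0.le
  set d := pdeg F (fun a : Fin n → Bool => decide (t ≤ wt a)) ε with hd
  have hLle : ∀ k : ℕ, 1 ≤ ε * 2 ^ k → Real.logb 2 (1 / ε) ≤ k := by
    intro k hk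
    rw [Real.logb_le_iff_le_rpow (by norm_num) (by positivity), Real.rpow_natCast,
      div_le_iff₀ h0]
    linarith
  have hor : d + t ≤ n → 1 ≤ ε * 2 ^ (d + 1) := by
    intro hdn
    have := averaging P _ ε herr (emb (d + 1) (t - 1) n) 1 (fun i => by
      have := or_bound d _ (DD_comp (emb (d + 1) (t - 1) n) emb_mem (poly_mem (P.poly i) (hdeg i)))
      refine this.trans (Finset.card_le_card fun a ha => ?_)
      have ha := (Finset.mem_filter.1 ha).2
      refine Finset.mem_filter.2 ⟨Finset.mem_univ _, ?_⟩
      have hiff : 1 ≤ wt a ↔ t ≤ wt a + (t - 1) := by omega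
      simp only [wt_emb (show d + 1 + (t - 1) ≤ n by omega), ← hiff]
      exact ha)
    exact_mod_cast this
  have hd1 : 1 ≤ d := by
    by_contra hc
    have hd0 : d = 0 := by omega
    have := hor (by omega)
    rw [hd0] at this
    norm_num at this
    linarith
  have hd1' : (1 : ℝ) ≤ d := by exact_mod_cast hd1
  have hL : Real.logb 2 (1 / ε) ≤ 2 * d := by
    by_cases hdn : d + t ≤ n
    · have := hLle _ (hor hdn)
      push_cast at this
      linarith
    · have h1 : Real.logb 2 (1 / ε) ≤ n := hLle n (by
        rwa [div_le_iff₀ (by positivity)] at hε)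
      have h2 : (n : ℝ) ≤ 2 * d := by
        have : n ≤ 2 * d := by omega
        exact_mod_cast this
      linarith
  have hT : (tail t d : ℝ) ≤ ε * 4 ^ t := by
    have := averaging P _ ε herr (emb (2 * t) 0 n) (tail t d) (fun i => by
      have := smolensky t d _ (DD_comp (emb (2 * t) 0 n) emb_mem (poly_mem (P.poly i) (hdeg i)))
      refine this.trans (Finset.card_le_card fun a ha => ?_)
      have ha := (Finset.mem_filter.1 ha).2
      refine Finset.mem_filter.2 ⟨Finset.mem_univ _, ?_⟩
      simp only [wt_emb (show 2 * t + 0 ≤ n by omega), add_zero]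
      exact ha)
    rw [pow_mul] at this
    norm_num at this
    exact this
  have hs := Real.sqrt_le_sqrt (analytic t d ht hd1 ε h0 hε3 hL hT)
  rw [Real.sqrt_sq (by positivity)] at hs
  linarith
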